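/- (Reflection) Let A be a Seifert matrix of type (m_1,…,m_n); then Aᵀ is also a Seifert matrix of the same type, and for every noncommutative polynomial f in ℚ⟨x,z⟩, χ_f(Aᵀ) = rev(χ_{f̃}(A)), where f̃ is the reversal of f and rev is the reversal anti-automorphism of F_n. -/

import Mathlib

open Matrix

/-- Index type for `m × m` matrices partitioned into `n` blocks, the `i`-th of size `msize i`. -/
abbrev BlkIdx {n : ℕ} (msize : Fin n → ℕ) : Type := (i : Fin n) × Fin (msize i)

/-- The block-diagonal matrix `X` over the free algebra `F_n = ℚ⟨x_1,…,x_n⟩`,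
whose `i`-th diagonal block is `x_i` times the identity. -/
noncomputable def Xblk {n : ℕ} (msize : Fin n → ℕ) :
    Matrix (BlkIdx msize) (BlkIdx msize) (FreeAlgebra ℚ (Fin n)) :=
  Matrix.diagonal fun p => FreeAlgebra.ι ℚ p.1

/-- `Z_A = A · (A − Aᵀ)⁻¹`. -/
noncomputable def Zof {ι : Type*} [Fintype ι] [DecidableEq ι] (A : Matrix ι ι ℚ) :
    Matrix ι ι ℚ :=
  A * (A - Aᵀ)⁻¹

/-- Evaluation `f ↦ f(X, Z)` : the image of `f ∈ ℚ⟨x,z⟩` under the algebra homomorphism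
`ℚ⟨x,z⟩ → M_m(F_n)`, `x ↦ X`, `z ↦ Z`. -/
noncomputable def evalf {n : ℕ} {ι : Type*} [Fintype ι] [DecidableEq ι]
    (X Z : Matrix ι ι (FreeAlgebra ℚ (Fin n))) (f : FreeAlgebra ℚ (Fin 2)) :
    Matrix ι ι (FreeAlgebra ℚ (Fin n)) :=
  FreeAlgebra.lift ℚ ![X, Z] f

/-- A Seifert matrix of type `(msize 1, …, msize n)`: an integer matrix with blocks `A_{ij}`
satisfying `(A_{ij})ᵀ = A_{ji}` for `i ≠ j` and `det (A_{ii} − (A_{ii})ᵀ) = 1` for all `i`. -/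
def IsSeifert {n : ℕ} (msize : Fin n → ℕ)
    (A : Matrix (BlkIdx msize) (BlkIdx msize) ℤ) : Prop :=
  (∀ (i j : Fin n), i ≠ j → ∀ (a : Fin (msize i)) (b : Fin (msize j)),
      A ⟨i, a⟩ ⟨j, b⟩ = A ⟨j, b⟩ ⟨i, a⟩) ∧
  (∀ i : Fin n, (Matrix.of fun a b : Fin (msize i) =>
      A ⟨i, a⟩ ⟨i, b⟩ - A ⟨i, b⟩ ⟨i, a⟩).det = 1)

/-- A diagonal-entry function taking values in `{0,1}` with exactly half of the entries in
each block equal to `1` (the matrix `I_{1/2}`). -/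
def IsHalfOnes {n : ℕ} (msize : Fin n → ℕ) (d : BlkIdx msize → ℚ) : Prop :=
  (∀ p, d p = 0 ∨ d p = 1) ∧
  (∀ i : Fin n,
    2 * (Finset.univ.filter fun a : Fin (msize i) => d ⟨i, a⟩ = 1).card = msize i)

/-- The reversal anti-automorphism of a free associative algebra, fixing each generator. -/
noncomputable def rev {σ : Type*} (a : FreeAlgebra ℚ σ) : FreeAlgebra ℚ σ :=
  MulOpposite.unop
    (FreeAlgebra.lift ℚ (fun i => MulOpposite.op (FreeAlgebra.ι ℚ i)) a)

/-- View a rational matrix as a matrix over the free algebra `F_n`. -/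
noncomputable def mapQ {n : ℕ} {ι κ : Type*} (Z : Matrix ι κ ℚ) :
    Matrix ι κ (FreeAlgebra ℚ (Fin n)) :=
  Z.map (algebraMap ℚ (FreeAlgebra ℚ (Fin n)))

lemma rev_add' {σ : Type*} (a b : FreeAlgebra ℚ σ) : rev (a + b) = rev a + rev b := by
  simp [rev]

lemma rev_sub' {σ : Type*} (a b : FreeAlgebra ℚ σ) : rev (a - b) = rev a - rev b := by
  simp [rev]

lemma rev_mul' {σ : Type*} (a b : FreeAlgebra ℚ σ) : rev (a * b) = rev b * rev a := by
  simp [rev]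

lemma rev_alg {σ : Type*} (r : ℚ) :
    rev (algebraMap ℚ (FreeAlgebra ℚ σ) r) = algebraMap ℚ (FreeAlgebra ℚ σ) r := by
  unfold rev
  rw [AlgHom.commutes]
  rfl

lemma rev_ι {σ : Type*} (i : σ) : rev (FreeAlgebra.ι ℚ i) = FreeAlgebra.ι ℚ i := by
  simp [rev]

lemma rev_sum' {σ κ : Type*} (s : Finset κ) (g : κ → FreeAlgebra ℚ σ) :
    rev (∑ i ∈ s, g i) = ∑ i ∈ s, rev (g i) := by
  simp [rev]

lemma rev_zero' {σ : Type*} : rev (0 : FreeAlgebra ℚ σ) = 0 := by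
  simp [rev]

lemma rev_one' {σ : Type*} : rev (1 : FreeAlgebra ℚ σ) = 1 := by
  simp [rev]

lemma evalf_transpose {n : ℕ} (msize : Fin n → ℕ)
    (Z : Matrix (BlkIdx msize) (BlkIdx msize) ℚ) (f : FreeAlgebra ℚ (Fin 2)) :
    evalf (Xblk msize) (mapQ Zᵀ) f = (evalf (Xblk msize) (mapQ Z) (rev f))ᵀ.map rev := by
  induction f using FreeAlgebra.induction with
  | grade0 r =>
    rw [rev_alg]
    unfold evalf
    simp only [AlgHom.commutes]
    ext i j
    simp only [Matrix.algebraMap_matrix_apply, Matrix.map_apply, Matrix.transpose_apply]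
    by_cases h : i = j
    · simp [h, rev_alg]
    · simp [h, Ne.symm h, rev_zero']
  | grade1 x =>
    rw [rev_ι]
    unfold evalf
    simp only [FreeAlgebra.lift_ι_apply]
    fin_cases x
    · ext i j
      by_cases h : i = j
      · simp [Xblk, h, rev_ι]
      · simp [Xblk, h, rev_zero']
    · ext i j
      simp [mapQ, rev_alg]
  | mul a b ha hb =>
    rw [rev_mul']
    unfold evalf at *
    rw [map_mul, map_mul, ha, hb]
    ext i j
    simp only [Matrix.mul_apply, Matrix.map_apply, Matrix.transpose_apply, rev_sum', rev_mul']
  | add a b ha hb =>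
    rw [rev_add']
    unfold evalf at *
    rw [map_add, map_add, ha, hb]
    ext i j
    simp [rev_add']

lemma evalf_conj {n : ℕ} {ι : Type*} [Fintype ι] [DecidableEq ι]
    (X Z W S : Matrix ι ι (FreeAlgebra ℚ (Fin n)))
    (hX : X * S = S * X) (hZ : W * S = S * Z) (f : FreeAlgebra ℚ (Fin 2)) :
    evalf X W f * S = S * evalf X Z f := by
  unfold evalf
  induction f using FreeAlgebra.induction with
  | grade0 r => simp only [AlgHom.commutes]; exact Algebra.commutes _ _
  | grade1 x =>
    simp only [FreeAlgebra.lift_ι_apply]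
    fin_cases x
    · simpa using hX
    · simpa using hZ
  | mul a b ha hb => rw [map_mul, map_mul, mul_assoc, hb, ← mul_assoc, ha, mul_assoc]
  | add a b ha hb => rw [map_add, map_add, add_mul, ha, hb, mul_add]

lemma mapQ_mul {n : ℕ} {ι : Type*} [Fintype ι] (P Q : Matrix ι ι ℚ) :
    (mapQ (P * Q) : Matrix ι ι (FreeAlgebra ℚ (Fin n))) = mapQ P * mapQ Q := by
  unfold mapQ
  exact Matrix.map_mul

lemma trace_mapQ_comm {n : ℕ} {ι : Type*} [Fintype ι] (P : Matrix ι ι ℚ)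
    (M : Matrix ι ι (FreeAlgebra ℚ (Fin n))) :
    (mapQ P * M).trace = (M * mapQ P).trace := by
  simp only [Matrix.trace, Matrix.diag, Matrix.mul_apply, mapQ, Matrix.map_apply]
  rw [Finset.sum_comm]
  exact Finset.sum_congr rfl fun i _ => Finset.sum_congr rfl fun j _ => Algebra.commutes _ _

lemma evalf_diag {n : ℕ} (msize : Fin n → ℕ) (d : BlkIdx msize → ℚ)
    (f : FreeAlgebra ℚ (Fin 2)) :
    evalf (Xblk msize) (mapQ (Matrix.diagonal d)) f =
      Matrix.diagonal fun p => FreeAlgebra.lift ℚ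
        ![FreeAlgebra.ι ℚ p.1, algebraMap ℚ (FreeAlgebra ℚ (Fin n)) (d p)] f := by
  unfold evalf
  induction f using FreeAlgebra.induction with
  | grade0 r => simp only [AlgHom.commutes]; rfl
  | grade1 x =>
    simp only [FreeAlgebra.lift_ι_apply]
    fin_cases x
    · simp [Xblk]
    · ext i j
      by_cases h : i = j
      · simp [mapQ, h]
      · simp [mapQ, h]
  | mul a b ha hb => simp only [map_mul, ha, hb, Matrix.diagonal_mul_diagonal]
  | add a b ha hb => simp only [map_add, ha, hb, Matrix.diagonal_add]

lemma half_sum {n : ℕ} (msize : Fin n → ℕ) (d : BlkIdx msize → ℚ) (hd : IsHalfOnes msize d)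
    {M : Type*} [AddCommMonoid M] (g : Fin n → ℚ → M) :
    ∑ p, g p.1 (d p) = ∑ i, ((msize i / 2) • g i 1 + (msize i / 2) • g i 0) := by
  rw [Fintype.sum_sigma]
  refine Finset.sum_congr rfl fun i _ => ?_
  rw [← Finset.sum_filter_add_sum_filter_not _ (fun a => d ⟨i, a⟩ = 1)]
  have h1 := hd.2 i
  have h2 := Finset.card_filter_add_card_filter_not (s := Finset.univ)
    (fun a : Fin (msize i) => d ⟨i, a⟩ = 1)
  rw [Finset.card_univ, Fintype.card_fin] at h2
  congr 1
  · rw [Finset.sum_congr rfl (g := fun _ => g i 1), Finset.sum_const]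
    · congr 1; omega
    · intro a ha
      rw [(Finset.mem_filter.1 ha).2]
  · rw [Finset.sum_congr rfl (g := fun _ => g i 0), Finset.sum_const]
    · congr 1; omega
    · intro a ha
      rw [(hd.1 ⟨i, a⟩).resolve_right (Finset.mem_filter.1 ha).2]

lemma trace_half {n : ℕ} (msize : Fin n → ℕ) (d d' : BlkIdx msize → ℚ)
    (hd : IsHalfOnes msize d) (hd' : IsHalfOnes msize d') (f : FreeAlgebra ℚ (Fin 2)) :
    (evalf (Xblk msize) (mapQ (Matrix.diagonal d)) f).trace =
      (evalf (Xblk msize) (mapQ (Matrix.diagonal d')) f).trace := by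
  rw [evalf_diag, evalf_diag, Matrix.trace_diagonal, Matrix.trace_diagonal]
  rw [half_sum msize d hd (fun i q => FreeAlgebra.lift ℚ
        ![FreeAlgebra.ι ℚ i, algebraMap ℚ (FreeAlgebra ℚ (Fin n)) q] f),
    half_sum msize d' hd' (fun i q => FreeAlgebra.lift ℚ
        ![FreeAlgebra.ι ℚ i, algebraMap ℚ (FreeAlgebra ℚ (Fin n)) q] f)]

lemma trace_rev {n : ℕ} {ι : Type*} [Fintype ι] (M : Matrix ι ι (FreeAlgebra ℚ (Fin n))) :
    (Mᵀ.map rev).trace = rev M.trace := by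
  simp [Matrix.trace, rev_sum']

lemma seifert_blockDiag {n : ℕ} (msize : Fin n → ℕ)
    (A : Matrix (BlkIdx msize) (BlkIdx msize) ℤ) (hA : IsSeifert msize A) :
    A - Aᵀ = Matrix.blockDiagonal' fun i => (Matrix.of fun a b : Fin (msize i) =>
      A ⟨i, a⟩ ⟨i, b⟩ - A ⟨i, b⟩ ⟨i, a⟩) := by
  ext ⟨i, a⟩ ⟨j, b⟩
  by_cases h : i = j
  · subst h
    simp
  · rw [Matrix.blockDiagonal'_apply_ne _ _ _ h]
    simp [hA.1 i j h a b]

lemma seifert_det {n : ℕ} (msize : Fin n → ℕ)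
    (A : Matrix (BlkIdx msize) (BlkIdx msize) ℤ) (hA : IsSeifert msize A) :
    IsUnit (A - Aᵀ).det := by
  rw [seifert_blockDiag msize A hA]
  apply Matrix.isUnit_det_of_right_inverse (B := Matrix.blockDiagonal' fun i =>
    (Matrix.of fun a b : Fin (msize i) => A ⟨i, a⟩ ⟨i, b⟩ - A ⟨i, b⟩ ⟨i, a⟩)⁻¹)
  rw [← Matrix.blockDiagonal'_mul, ← Matrix.blockDiagonal'_one]
  congr 1
  funext i
  exact Matrix.mul_nonsing_inv _ (by rw [hA.2 i]; exact isUnit_one)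

lemma seifert_transpose {n : ℕ} (msize : Fin n → ℕ)
    (A : Matrix (BlkIdx msize) (BlkIdx msize) ℤ) (hA : IsSeifert msize A) :
    IsSeifert msize Aᵀ := by
  refine ⟨fun i j h a b => (hA.1 i j h a b).symm, fun i => ?_⟩
  rw [← hA.2 i, ← Matrix.det_transpose]
  rfl

lemma zof_conj {ι : Type*} [Fintype ι] [DecidableEq ι] (B : Matrix ι ι ℚ)
    (h : IsUnit (B - Bᵀ).det) : Zof Bᵀ * (B - Bᵀ) = (B - Bᵀ) * (Zof B)ᵀ := by
  have h1 : (Bᵀ - B)⁻¹ = -(B - Bᵀ)⁻¹ := by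
    apply Matrix.inv_eq_right_inv
    rw [← neg_sub, neg_mul_neg, Matrix.mul_nonsing_inv _ h]
  unfold Zof
  rw [Matrix.transpose_mul, Matrix.transpose_nonsing_inv, Matrix.transpose_sub,
    Matrix.transpose_transpose, h1, Matrix.mul_neg, Matrix.neg_mul, Matrix.mul_assoc,
    Matrix.nonsing_inv_mul _ h, Matrix.neg_mul, Matrix.mul_neg, ← Matrix.mul_assoc,
    Matrix.mul_nonsing_inv _ h, Matrix.mul_one, Matrix.one_mul]

/-- Reflection: `Aᵀ` is again a Seifert matrix and
`χ_f(Aᵀ) = rev (χ_{f̃}(A))`. -/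
theorem stmt10 {n : ℕ} (hn : 1 ≤ n) (msize : Fin n → ℕ)
    (hpos : ∀ i, 0 < msize i) (heven : ∀ i, Even (msize i))
    (A : Matrix (BlkIdx msize) (BlkIdx msize) ℤ) (hA : IsSeifert msize A) :
    IsSeifert msize Aᵀ ∧
    ∀ f : FreeAlgebra ℚ (Fin 2),
      ∀ d d' : BlkIdx msize → ℚ, IsHalfOnes msize d → IsHalfOnes msize d' →
      (evalf (Xblk msize) (mapQ (Zof (Aᵀ.map ((↑) : ℤ → ℚ)))) f).trace -
        (evalf (Xblk msize) (mapQ (Matrix.diagonal d)) f).trace =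
      rev ((evalf (Xblk msize) (mapQ (Zof (A.map ((↑) : ℤ → ℚ)))) (rev f)).trace -
        (evalf (Xblk msize) (mapQ (Matrix.diagonal d')) (rev f)).trace) := by
  refine ⟨seifert_transpose msize A hA, fun f d d' hd hd' => ?_⟩
  rw [rev_sub', ← trace_rev, ← trace_rev, ← evalf_transpose, ← evalf_transpose,
    Matrix.diagonal_transpose, trace_half msize d d' hd hd' f]
  congr 1
  rw [Matrix.transpose_map]
  set B : Matrix (BlkIdx msize) (BlkIdx msize) ℚ := A.map ((↑) : ℤ → ℚ) with hB
  have hS : B - Bᵀ = (Int.castRingHom ℚ).mapMatrix (A - Aᵀ) := by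
    ext i j
    simp [hB]
  have hdet : IsUnit (B - Bᵀ).det := by
    rw [hS, ← RingHom.map_det]
    exact (seifert_det msize A hA).map _
  have hone : (mapQ (1 : Matrix (BlkIdx msize) (BlkIdx msize) ℚ) :
      Matrix _ _ (FreeAlgebra ℚ (Fin n))) = 1 := by
    simp [mapQ]
  have hST : (mapQ (B - Bᵀ) : Matrix _ _ (FreeAlgebra ℚ (Fin n))) * mapQ (B - Bᵀ)⁻¹ = 1 := by
    rw [← mapQ_mul, Matrix.mul_nonsing_inv _ hdet, hone]
  have hX : Xblk msize * mapQ (B - Bᵀ) = mapQ (B - Bᵀ) * Xblk msize := by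
    ext ⟨i, a⟩ ⟨j, b⟩
    simp only [Xblk, Matrix.diagonal_mul, Matrix.mul_diagonal]
    by_cases h : i = j
    · subst h
      exact (Algebra.commutes ((B - Bᵀ) ⟨i, a⟩ ⟨i, b⟩)
        (FreeAlgebra.ι ℚ i : FreeAlgebra ℚ (Fin n))).symm
    · simp [mapQ, hB, hA.1 i j h a b]
  have hZ : (mapQ (Zof Bᵀ) : Matrix _ _ (FreeAlgebra ℚ (Fin n))) * mapQ (B - Bᵀ) =
      mapQ (B - Bᵀ) * mapQ (Zof B)ᵀ := by
    rw [← mapQ_mul, ← mapQ_mul, zof_conj B hdet]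
  have key := evalf_conj (Xblk msize) (mapQ (Zof B)ᵀ) (mapQ (Zof Bᵀ)) (mapQ (B - Bᵀ)) hX hZ f
  have hTS : (mapQ (B - Bᵀ)⁻¹ : Matrix _ _ (FreeAlgebra ℚ (Fin n))) * mapQ (B - Bᵀ) = 1 := by
    rw [← mapQ_mul, Matrix.nonsing_inv_mul _ hdet, hone]
  calc (evalf (Xblk msize) (mapQ (Zof Bᵀ)) f).trace
      = (evalf (Xblk msize) (mapQ (Zof Bᵀ)) f * mapQ (B - Bᵀ) * mapQ (B - Bᵀ)⁻¹).trace := by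
        rw [Matrix.mul_assoc, hST, Matrix.mul_one]
    _ = (evalf (Xblk msize) (mapQ (Zof B)ᵀ) f).trace := by
        rw [← trace_mapQ_comm, key, ← Matrix.mul_assoc, hTS, Matrix.one_mul]
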